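/- (FDR-linking theorem for compliant procedures.) Under arbitrary dependence of the p-values (only super-uniformity of the null p-values is assumed), every multiple testing procedure that is compliant at level α ∈ (0,1) satisfies FDR ≤ π_0 α + π_0 α ∫_{π_0 α}^{1} FDR_0(x)/x² dx, where FDR_0(x) refers to the BH procedure applied to the null p-values. -/

import Mathlib

open MeasureTheory Finset

attribute [local instance] Classical.propDecidable

/-- Number of rejections of the Benjamini–Hochberg (step-up) procedure at level `α`
applied to the family of p-values `p` indexed by `ι`: the largest `j` such that the
`j`-th smallest p-value is at most `α j / n` (equivalently, at least `j` of the
p-values are at most `α j / n`), and `0` if there is no such `j ≥ 1`. -/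
noncomputable def bhNumRejections {ι : Type*} [Fintype ι] (α : ℝ) (p : ι → ℝ) : ℕ :=
  Nat.findGreatest
    (fun j => j ≤ (Finset.univ.filter (fun i => p i ≤ α * (j : ℝ) / (Fintype.card ι : ℝ))).card)
    (Fintype.card ι)

/-- False discovery proportion `V / max{R, 1}` of the BH procedure at level `α`
with set of true null hypotheses `N₀`. -/
noncomputable def bhFDP {ι : Type*} [Fintype ι] (α : ℝ) (N₀ : Finset ι) (p : ι → ℝ) : ℝ :=
  ((N₀.filter (fun i => p i ≤ α * (bhNumRejections α p : ℝ) / (Fintype.card ι : ℝ))).card : ℝ) /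
    ((max (bhNumRejections α p) 1 : ℕ) : ℝ)

/-- False discovery rate (expected FDP) of the BH procedure at level `α`. -/
noncomputable def bhFDR {Ω : Type*} [MeasurableSpace Ω] {ι : Type*} [Fintype ι]
    (μ : Measure Ω) (α : ℝ) (N₀ : Finset ι) (p : ι → Ω → ℝ) : ℝ :=
  ∫ ω, bhFDP α N₀ (fun i => p i ω) ∂μ

/-- False discovery proportion `V / max{R,1}` of a multiple testing procedure with
rejection set `Rset`, where `N₀` is the set of true null hypotheses. -/
noncomputable def procFDP {ι : Type*} (N₀ Rset : Finset ι) : ℝ :=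
  ((Rset ∩ N₀).card : ℝ) / ((max Rset.card 1 : ℕ) : ℝ)

/-- A rejection set `Rset` is compliant at level `α` if every rejected p-value `p j`
satisfies `p j ≤ α ⋅ |Rset| / n`. -/
def IsCompliant {ι : Type*} [Fintype ι] (α : ℝ) (p : ι → ℝ) (Rset : Finset ι) : Prop :=
  ∀ j ∈ Rset, p j ≤ α * (Rset.card : ℝ) / (Fintype.card ι : ℝ)

theorem measurable_card_filter_le {ι β : Type*} [Fintype ι] [MeasurableSpace β]
    {f : ι → β → ℝ} {g : β → ℝ} (hf : ∀ i, Measurable (f i)) (hg : Measurable g) :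
    Measurable fun b => (Finset.univ.filter (fun i => f i b ≤ g b)).card := by
  simp only [Finset.card_filter]
  exact Finset.measurable_sum _ fun i _ =>
    Measurable.ite (measurableSet_le (hf i) hg) measurable_const measurable_const

theorem measurable_bhNumRejections {ι β : Type*} [Fintype ι] [MeasurableSpace β]
    {f : ι → β → ℝ} {g : β → ℝ} (hf : ∀ i, Measurable (f i)) (hg : Measurable g) :
    Measurable fun b => bhNumRejections (g b) (fun i => f i b) := by
  unfold bhNumRejections
  refine measurable_findGreatest fun k _ => ?_
  exact measurableSet_le measurable_const
    (measurable_card_filter_le hf ((hg.mul_const _).div_const _))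

theorem measurable_bhFDP_univ {ι β : Type*} [Fintype ι] [MeasurableSpace β]
    {f : ι → β → ℝ} {g : β → ℝ} (hf : ∀ i, Measurable (f i)) (hg : Measurable g) :
    Measurable fun b => bhFDP (g b) Finset.univ (fun i => f i b) := by
  have hR := measurable_bhNumRejections hf hg
  have hcast : Measurable fun k : ℕ => (k : ℝ) := measurable_from_top
  unfold bhFDP
  refine (hcast.comp (measurable_card_filter_le hf
    ((hg.mul (hcast.comp hR)).div_const _))).div (hcast.comp (hR.max measurable_const))

theorem bhFDP_nonneg {ι : Type*} [Fintype ι] (x : ℝ) (N₀ : Finset ι) (p : ι → ℝ) :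
    0 ≤ bhFDP x N₀ p := by
  unfold bhFDP
  positivity

theorem bhFDP_le_card {ι : Type*} [Fintype ι] (x : ℝ) (N₀ : Finset ι) (p : ι → ℝ) :
    bhFDP x N₀ p ≤ N₀.card := by
  unfold bhFDP
  refine (div_le_self (by positivity) ?_).trans ?_
  · exact_mod_cast le_max_right _ _
  · exact_mod_cast Finset.card_filter_le _ _

/-- If some positive number `j` of p-values lie below the `j`-th critical value, then the BH
procedure rejects, so its false discovery proportion under the global null is at least `1`. -/
theorem one_le_bhFDP_univ {ι : Type*} [Fintype ι] {x : ℝ} {p : ι → ℝ} {j : ℕ} (hj : 0 < j)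
    (hle : j ≤ (Finset.univ.filter
      (fun i => p i ≤ x * (j : ℝ) / (Fintype.card ι : ℝ))).card) :
    1 ≤ bhFDP x Finset.univ p := by
  have hjm : j ≤ Fintype.card ι := hle.trans (Finset.card_le_univ _)
  have hjR : j ≤ bhNumRejections x p := Nat.le_findGreatest hjm hle
  have hR : bhNumRejections x p ≤ (Finset.univ.filter (fun i =>
      p i ≤ x * (bhNumRejections x p : ℝ) / (Fintype.card ι : ℝ))).card :=
    Nat.findGreatest_spec (P := fun j => j ≤ (Finset.univ.filter
      (fun i => p i ≤ x * (j : ℝ) / (Fintype.card ι : ℝ))).card) hjm hle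
  unfold bhFDP
  rw [max_eq_left (hj.trans_le hjR : 1 ≤ _), one_le_div (by exact_mod_cast hj.trans_le hjR)]
  exact_mod_cast hR

/-- If a compliant procedure at level `α` has false discovery proportion `F`, then the BH
procedure applied to the null p-values rejects at every level `x` with `π₀ α ≤ x F`. -/
theorem one_le_bhFDP_null_of_isCompliant {ι : Type*} [Fintype ι] {α x : ℝ} {p : ι → ℝ}
    {N₀ S : Finset ι} (hS : IsCompliant α p S) (hF : 0 < procFDP N₀ S)
    (hx : (N₀.card : ℝ) / Fintype.card ι * α ≤ x * procFDP N₀ S) :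
    1 ≤ bhFDP x (Finset.univ : Finset {i // i ∈ N₀}) (fun i => p i.1) := by
  have hV : 0 < (S ∩ N₀).card := by
    rw [Nat.pos_iff_ne_zero]
    intro h
    simp [procFDP, h] at hF
  have hR : 0 < S.card := hV.trans_le (Finset.card_le_card Finset.inter_subset_left)
  have hm : 0 < N₀.card := hV.trans_le (Finset.card_le_card Finset.inter_subset_right)
  have hRr : (0 : ℝ) < S.card := by exact_mod_cast hR
  have hmr : (0 : ℝ) < N₀.card := by exact_mod_cast hm
  refine one_le_bhFDP_univ hV ?_
  rw [Fintype.card_coe]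
  rw [← Finset.card_map (Function.Embedding.subtype fun i => i ∈ N₀)]
  refine Finset.card_le_card fun i hi => ?_
  obtain ⟨hiS, hiN⟩ := Finset.mem_inter.1 hi
  simp only [Finset.mem_map, Finset.mem_filter, Finset.mem_univ, true_and]
  refine ⟨⟨i, hiN⟩, (hS i hiS).trans ?_, rfl⟩
  rw [procFDP, max_eq_left (Nat.one_le_iff_ne_zero.2 hR.ne')] at hx
  rw [le_div_iff₀ hmr]
  calc α * S.card / Fintype.card ι * N₀.card
      = (N₀.card : ℝ) / Fintype.card ι * α * S.card := by ring
    _ ≤ x * ((S ∩ N₀).card / S.card) * S.card := by gcongr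
    _ = x * (S ∩ N₀).card := by field_simp

theorem procFDP_nonneg {ι : Type*} (N₀ S : Finset ι) : 0 ≤ procFDP N₀ S := by
  unfold procFDP
  positivity

theorem procFDP_le_one {ι : Type*} (N₀ S : Finset ι) : procFDP N₀ S ≤ 1 := by
  unfold procFDP
  refine div_le_one_of_le₀ ?_ (by positivity)
  exact_mod_cast (Finset.card_le_card Finset.inter_subset_left).trans (le_max_left _ _)

/-- A nonnegative function that is at least `1` on `[a / F, 1]` has `x⁻²`-weighted integral
over `[a, 1]` at least `F / a - 1`. -/
theorem le_add_mul_integral_div_sq {a F : ℝ} {φ : ℝ → ℝ} (ha : 0 < a) (ha1 : a ≤ 1)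
    (hF1 : F ≤ 1) (hφ0 : ∀ x, 0 ≤ φ x) (hφ : 0 < F → ∀ x, a ≤ x * F → 1 ≤ φ x)
    (hint : IntervalIntegrable (fun x => φ x / x ^ 2) volume a 1) :
    F ≤ a + a * ∫ x in a..1, φ x / x ^ 2 := by
  have hnn : ∀ x, 0 ≤ φ x / x ^ 2 := fun x => div_nonneg (hφ0 x) (sq_nonneg x)
  rcases le_or_gt F a with hFa | hFa
  · have := intervalIntegral.integral_nonneg (μ := volume) ha1 fun x _ => hnn x
    nlinarith
  have hF : 0 < F := ha.trans hFa
  set b := a / F with hb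
  have hb0 : 0 < b := div_pos ha hF
  have hab : a ≤ b := le_div_self ha.le hF hF1
  have hb1 : b ≤ 1 := (div_le_one hF).2 hFa.le
  have hcont : ContinuousOn (fun x : ℝ => 1 / x ^ 2) (Set.uIcc b 1) := by
    refine continuousOn_const.div (continuousOn_id.pow 2) fun x hx => ?_
    rw [Set.uIcc_of_le hb1] at hx
    exact pow_ne_zero 2 (hb0.trans_le hx.1).ne'
  have hval : ∫ x in b..1, 1 / x ^ 2 = F / a - 1 := by
    rw [intervalIntegral.integral_eq_sub_of_hasDerivAt (f := fun x => -x⁻¹) (fun x hx => ?_)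
      hcont.intervalIntegrable]
    · simp only [hb, inv_div, inv_one]; ring
    · rw [Set.uIcc_of_le hb1] at hx
      simpa using (hasDerivAt_inv (hb0.trans_le hx.1).ne').fun_neg
  have hint' : IntervalIntegrable (fun x => φ x / x ^ 2) volume b 1 :=
    hint.mono_set (by
      rw [Set.uIcc_of_le hb1, Set.uIcc_of_le ha1]; exact Set.Icc_subset_Icc_left hab)
  have hle : F / a - 1 ≤ ∫ x in a..1, φ x / x ^ 2 := by
    rw [← hval]
    calc ∫ x in b..1, 1 / x ^ 2 ≤ ∫ x in b..1, φ x / x ^ 2 := by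
          refine intervalIntegral.integral_mono_on hb1 hcont.intervalIntegrable hint'
            fun x hx => ?_
          have := hφ hF x ((div_le_iff₀ hF).1 hx.1)
          gcongr
      _ ≤ ∫ x in a..1, φ x / x ^ 2 :=
          intervalIntegral.integral_mono_interval hab hb1 le_rfl
            (Filter.Eventually.of_forall hnn) hint
  calc F = a + a * (F / a - 1) := by field_simp; ring
    _ ≤ _ := by gcongr

/-- Integrated form of `le_add_mul_integral_div_sq` for a jointly measurable family. -/
theorem integral_le_add_mul_integral_div_sq {Ω : Type*} [MeasurableSpace Ω] (μ : Measure Ω)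
    [IsProbabilityMeasure μ] {a C : ℝ} {F : Ω → ℝ} {φ : ℝ → Ω → ℝ} (ha : 0 < a) (ha1 : a ≤ 1)
    (hF0 : ∀ ω, 0 ≤ F ω) (hF1 : ∀ ω, F ω ≤ 1) (hφm : Measurable fun z : ℝ × Ω => φ z.1 z.2)
    (hφ0 : ∀ x ω, 0 ≤ φ x ω) (hφC : ∀ x ω, φ x ω ≤ C)
    (hφ : ∀ ω, 0 < F ω → ∀ x, a ≤ x * F ω → 1 ≤ φ x ω) :
    ∫ ω, F ω ∂μ ≤ a + a * ∫ x in a..1, (∫ ω, φ x ω ∂μ) / x ^ 2 := by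
  have hbound : ∀ x ∈ Set.Ioc a 1, ∀ ω, ‖φ x ω / x ^ 2‖ ≤ C / a ^ 2 := fun x hx ω => by
    rw [Real.norm_of_nonneg (div_nonneg (hφ0 x ω) (sq_nonneg x))]
    have := hx.1.le
    have hC := (hφ0 x ω).trans (hφC x ω)
    have := hφC x ω
    gcongr
  have hψm : Measurable fun z : ℝ × Ω => φ z.1 z.2 / z.1 ^ 2 :=
    hφm.div (measurable_fst.pow_const 2)
  have hprod : Integrable (Function.uncurry fun x ω => φ x ω / x ^ 2)
      ((volume.restrict (Set.Ioc a 1)).prod μ) := by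
    refine Integrable.of_bound hψm.aestronglyMeasurable (C / a ^ 2) ?_
    have hfst : ∀ᵐ z ∂((volume.restrict (Set.Ioc a 1)).prod μ), z.1 ∈ Set.Ioc a 1 :=
      Measure.quasiMeasurePreserving_fst.ae (ae_restrict_mem measurableSet_Ioc)
    filter_upwards [hfst] with z hz using hbound z.1 hz z.2
  have hslice : ∀ ω, IntervalIntegrable (fun x => φ x ω / x ^ 2) volume a 1 := fun ω => by
    rw [intervalIntegrable_iff_integrableOn_Ioc_of_le ha1]
    refine Integrable.of_bound
      (hψm.comp (measurable_id.prodMk measurable_const)).aestronglyMeasurable (C / a ^ 2) ?_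
    filter_upwards [ae_restrict_mem measurableSet_Ioc] with x hx using hbound x hx ω
  have hint : Integrable (fun ω => ∫ x in a..1, φ x ω / x ^ 2) μ := by
    simp only [intervalIntegral.integral_of_le ha1]
    exact hprod.integral_prod_right
  calc ∫ ω, F ω ∂μ
      ≤ ∫ ω, (a + a * ∫ x in a..1, φ x ω / x ^ 2) ∂μ :=
        integral_mono_of_nonneg (Filter.Eventually.of_forall hF0)
          ((integrable_const a).add (hint.const_mul a)) (Filter.Eventually.of_forall fun ω =>
            le_add_mul_integral_div_sq ha ha1 (hF1 ω) (hφ0 · ω) (hφ ω) (hslice ω))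
    _ = a + a * ∫ ω, (∫ x in a..1, φ x ω / x ^ 2) ∂μ := by
        rw [integral_add (integrable_const a) (hint.const_mul a), integral_const_mul]
        simp
    _ = a + a * ∫ x in a..1, (∫ ω, φ x ω ∂μ) / x ^ 2 := by
        simp only [intervalIntegral.integral_of_le ha1, ← integral_div]
        rw [integral_integral_swap hprod]

/-- **The FDR-linking theorem for compliant procedures.** Under arbitrary dependence
of the p-values (only super-uniformity of the null p-values is assumed), every
multiple testing procedure that is compliant at level `α ∈ (0,1)` satisfies
`FDR ≤ π₀ α + π₀ α ∫_{π₀ α}^1 FDR₀(x)/x² dx`, where `FDR₀(x)` refers to the BH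
procedure applied to the null p-values. -/
theorem fdr_linking_compliant
    {Ω : Type*} [MeasurableSpace Ω] (μ : Measure Ω) [IsProbabilityMeasure μ]
    {n : ℕ} (hn : 0 < n) (p : Fin n → Ω → ℝ)
    (hmeas : ∀ i, Measurable (p i))
    (hrange : ∀ i ω, p i ω ∈ Set.Icc (0:ℝ) 1)
    (N₀ : Finset (Fin n)) (hN₀ : 0 < N₀.card)
    (hnull : ∀ i ∈ N₀, ∀ t ∈ Set.Icc (0:ℝ) 1, μ {ω | p i ω ≤ t} ≤ ENNReal.ofReal t)
    {α : ℝ} (hα : 0 < α) (hα1 : α < 1)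
    (proc : Ω → Finset (Fin n))
    (hcomp : ∀ ω, IsCompliant α (fun i => p i ω) (proc ω))
    (hmeasFDP : Measurable fun ω => procFDP N₀ (proc ω)) :
    (∫ ω, procFDP N₀ (proc ω) ∂μ) ≤
      (N₀.card : ℝ) / n * α +
        (N₀.card : ℝ) / n * α *
          ∫ x in ((N₀.card : ℝ) / n * α)..1,
            (bhFDR μ x (Finset.univ : Finset {i // i ∈ N₀}) (fun i ω => p i.1 ω)) / x ^ 2 := by
  have hmr : (0 : ℝ) < N₀.card := by exact_mod_cast hN₀
  have hnr : (0 : ℝ) < n := by exact_mod_cast hn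
  have hπ : (N₀.card : ℝ) / n ≤ 1 := by
    rw [div_le_one hnr]
    exact_mod_cast (Finset.card_le_univ N₀).trans_eq (Fintype.card_fin n)
  exact integral_le_add_mul_integral_div_sq μ (mul_pos (div_pos hmr hnr) hα)
    (mul_le_one₀ hπ hα.le hα1.le)
    (fun ω => procFDP_nonneg _ _) (fun ω => procFDP_le_one _ _)
    (measurable_bhFDP_univ (f := fun (i : {i // i ∈ N₀}) (z : ℝ × Ω) => p i.1 z.2)
      (fun i => (hmeas i.1).comp measurable_snd) measurable_fst)
    (fun x ω => bhFDP_nonneg _ _ _) (fun x ω => bhFDP_le_card _ _ _)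
    (fun ω hF x hx => one_le_bhFDP_null_of_isCompliant (p := fun i => p i ω) (hcomp ω) hF
      (by rwa [Fintype.card_fin]))
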